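/- (First-order (ε,δ)-optimum threshold, general formula.) For any general source X and any ε, δ ∈ [0,1) satisfying ε + δ < 1, it holds that R(ε,δ|X) = G_{ε,δ}(X). -/

import Mathlib

open Filter MeasureTheory

namespace NY

/-- A probability distribution on a set, given by its point mass function. -/
structure Dist (α : Type*) where
  p : α → ℝ
  nonneg : ∀ x, 0 ≤ p x
  hasSum : HasSum p 1

/-- The probability of a set under a distribution. -/
noncomputable def Dist.pr {α : Type*} (P : Dist α) (A : Set α) : ℝ := ∑' x : A, P.p x.1

/-- 𝒰* : nonempty finite strings over the code alphabet 𝒰 = {1,…,K}. -/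
abbrev Word (K : ℕ) := {u : List (Fin K) // u ≠ []}

/-- Length of a string, as a real number. -/
noncomputable def wlen {K : ℕ} (u : Word K) : ℝ := u.1.length

/-- Error probability of a variable-length code (φ, ψ). -/
noncomputable def errP {α : Type*} {K : ℕ} (P : Dist α) (φ : α → Word K) (ψ : Word K → α) : ℝ :=
  P.pr {x | ψ (φ x) ≠ x}

/-- Overflow probability of an encoder φ with threshold η. -/
noncomputable def ovP {α : Type*} {K : ℕ} (P : Dist α) (φ : α → Word K) (η : ℝ) : ℝ :=
  P.pr {x | wlen (φ x) > η}

/-- A general source: for each blocklength n, a distribution on 𝒳^n. -/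
abbrev Source (𝒳 : Type*) := (n : ℕ) → Dist (Fin n → 𝒳)

/-- The limit as ν ↓ 0 of a function g which is nonincreasing in ν
(the limit exists by monotonicity and equals the supremum over ν > 0). -/
noncomputable def limNu (g : ℝ → ℝ) : ℝ := sSup (g '' Set.Ioi (0 : ℝ))

variable {𝒳 : Type*}

/-- A rate R ≥ 0 is (ε,δ)-achievable. -/
def FirstAch (K : ℕ) (X : Source 𝒳) (ε δ R : ℝ) : Prop :=
  0 ≤ R ∧ ∃ (φ : ∀ n, (Fin n → 𝒳) → Word K) (ψ : ∀ n, Word K → (Fin n → 𝒳)),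
    limsup (fun n => errP (X n) (φ n) (ψ n)) atTop ≤ ε ∧
    limsup (fun n => ovP (X n) (φ n) ((n : ℝ) * R)) atTop ≤ δ

/-- The first-order (ε,δ)-optimum threshold R(ε,δ|X). -/
noncomputable def Ropt (K : ℕ) (X : Source 𝒳) (ε δ : ℝ) : ℝ :=
  sInf {R | FirstAch K X ε δ R}

/-- L is (ε,δ,R)-achievable (second order). -/
def SecondAch (K : ℕ) (X : Source 𝒳) (ε δ R L : ℝ) : Prop :=
  ∃ (φ : ∀ n, (Fin n → 𝒳) → Word K) (ψ : ∀ n, Word K → (Fin n → 𝒳)),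
    limsup (fun n => errP (X n) (φ n) (ψ n)) atTop ≤ ε ∧
    limsup (fun n => ovP (X n) (φ n) ((n : ℝ) * R + Real.sqrt (n : ℝ) * L)) atTop ≤ δ

/-- The second-order (ε,δ,R)-optimum threshold L(ε,δ,R|X). -/
noncomputable def Lopt (K : ℕ) (X : Source 𝒳) (ε δ R : ℝ) : ℝ :=
  sInf {L | SecondAch K X ε δ R L}

/-- A rate R ≥ 0 is optimistically (ε,δ)-achievable. -/
def OptFirstAch (K : ℕ) (X : Source 𝒳) (ε δ R : ℝ) : Prop :=
  0 ≤ R ∧ ∃ (φ : ∀ n, (Fin n → 𝒳) → Word K) (ψ : ∀ n, Word K → (Fin n → 𝒳)),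
    ∀ γ > (0 : ℝ), ∃ ns : ℕ → ℕ, StrictMono ns ∧ ∀ i,
      errP (X (ns i)) (φ (ns i)) (ψ (ns i)) ≤ ε + γ ∧
      ovP (X (ns i)) (φ (ns i)) ((ns i : ℝ) * R) ≤ δ + γ

/-- The optimistic first-order (ε,δ)-optimum threshold R*(ε,δ|X). -/
noncomputable def RoptStar (K : ℕ) (X : Source 𝒳) (ε δ : ℝ) : ℝ :=
  sInf {R | OptFirstAch K X ε δ R}

/-- L is optimistically (ε,δ,R)-achievable. -/
def OptSecondAch (K : ℕ) (X : Source 𝒳) (ε δ R L : ℝ) : Prop :=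
  ∃ (φ : ∀ n, (Fin n → 𝒳) → Word K) (ψ : ∀ n, Word K → (Fin n → 𝒳)),
    ∀ γ > (0 : ℝ), ∃ ns : ℕ → ℕ, StrictMono ns ∧ ∀ i,
      errP (X (ns i)) (φ (ns i)) (ψ (ns i)) ≤ ε + γ ∧
      ovP (X (ns i)) (φ (ns i)) ((ns i : ℝ) * R + Real.sqrt (ns i : ℝ) * L) ≤ δ + γ

/-- The optimistic second-order (ε,δ,R)-optimum threshold L*(ε,δ,R|X). -/
noncomputable def LoptStar (K : ℕ) (X : Source 𝒳) (ε δ R : ℝ) : ℝ :=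
  sInf {L | OptSecondAch K X ε δ R L}

/-- A rate R ≥ 0 is type I (ε,δ)-achievable. -/
def TypeIAch (K : ℕ) (X : Source 𝒳) (ε δ R : ℝ) : Prop :=
  0 ≤ R ∧ ∃ (φ : ∀ n, (Fin n → 𝒳) → Word K) (ψ : ∀ n, Word K → (Fin n → 𝒳)),
    limsup (fun n => errP (X n) (φ n) (ψ n)) atTop ≤ ε ∧
    liminf (fun n => ovP (X n) (φ n) ((n : ℝ) * R)) atTop ≤ δ

/-- R†(ε,δ|X). -/
noncomputable def Rdagger (K : ℕ) (X : Source 𝒳) (ε δ : ℝ) : ℝ :=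
  sInf {R | TypeIAch K X ε δ R}

/-- A rate R ≥ 0 is type II (ε,δ)-achievable. -/
def TypeIIAch (K : ℕ) (X : Source 𝒳) (ε δ R : ℝ) : Prop :=
  0 ≤ R ∧ ∃ (φ : ∀ n, (Fin n → 𝒳) → Word K) (ψ : ∀ n, Word K → (Fin n → 𝒳)),
    liminf (fun n => errP (X n) (φ n) (ψ n)) atTop ≤ ε ∧
    limsup (fun n => ovP (X n) (φ n) ((n : ℝ) * R)) atTop ≤ δ

/-- R‡(ε,δ|X). -/
noncomputable def Rddagger (K : ℕ) (X : Source 𝒳) (ε δ : ℝ) : ℝ :=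
  sInf {R | TypeIIAch K X ε δ R}

/-- H̄_γ(X) := inf{ R : limsup_n Pr{ (1/n) log(1/P_{X^n}(X^n)) > R } ≤ γ }. -/
noncomputable def Hbar (K : ℕ) (X : Source 𝒳) (γ : ℝ) : ℝ :=
  sInf {R | limsup (fun n =>
    (X n).pr {x | Real.logb (K : ℝ) (1 / (X n).p x) / (n : ℝ) > R}) atTop ≤ γ}

/-- H̄*_γ(X) (optimistic version, with liminf). -/
noncomputable def HbarStar (K : ℕ) (X : Source 𝒳) (γ : ℝ) : ℝ :=
  sInf {R | liminf (fun n =>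
    (X n).pr {x | Real.logb (K : ℝ) (1 / (X n).p x) / (n : ℝ) > R}) atTop ≤ γ}

/-- H̄_γ(R|X) := inf{ L : limsup_n Pr{ (1/n) log(1/P_{X^n}(X^n)) > R + L/√n } ≤ γ }. -/
noncomputable def Hbar2 (K : ℕ) (X : Source 𝒳) (γ R : ℝ) : ℝ :=
  sInf {L | limsup (fun n =>
    (X n).pr {x | Real.logb (K : ℝ) (1 / (X n).p x) / (n : ℝ)
      > R + L / Real.sqrt (n : ℝ)}) atTop ≤ γ}

/-- H̄*_γ(R|X) (optimistic version, with liminf). -/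
noncomputable def Hbar2Star (K : ℕ) (X : Source 𝒳) (γ R : ℝ) : ℝ :=
  sInf {L | liminf (fun n =>
    (X n).pr {x | Real.logb (K : ℝ) (1 / (X n).p x) / (n : ℝ)
      > R + L / Real.sqrt (n : ℝ)}) atTop ≤ γ}

/-- F(ε,R) := limsup_n inf_{A : Pr(A) ≥ 1−ε} Pr{ −(1/n) log P_{X^n}(X^n) ≥ R, X^n ∈ A }. -/
noncomputable def Fspec (K : ℕ) (X : Source 𝒳) (ε R : ℝ) : ℝ :=
  limsup (fun n =>
    sInf ((fun A : Set (Fin n → 𝒳) =>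
        (X n).pr (A ∩ {x | -Real.logb (K : ℝ) ((X n).p x) / (n : ℝ) ≥ R})) ''
      {A | (X n).pr A ≥ 1 - ε})) atTop

/-- H̃_{ε,δ}(X) := inf{ R : F(ε,R) ≤ δ }. -/
noncomputable def Htilde (K : ℕ) (X : Source 𝒳) (ε δ : ℝ) : ℝ :=
  sInf {R | Fspec K X ε R ≤ δ}

/-- G_{ε,δ}(X). -/
noncomputable def Gfirst (K : ℕ) (X : Source 𝒳) (ε δ : ℝ) : ℝ :=
  sInf {R | limNu (fun ν => limsup (fun n =>
    sInf ((fun A : Set (Fin n → 𝒳) =>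
        (X n).pr (A ∩ {x | -Real.logb (K : ℝ) ((X n).p x / (X n).pr A) / (n : ℝ) ≥ R})) ''
      {A | (X n).pr A ≥ 1 - ε - ν})) atTop) ≤ δ}

/-- G*_{ε,δ}(X) (optimistic version, with liminf). -/
noncomputable def GfirstStar (K : ℕ) (X : Source 𝒳) (ε δ : ℝ) : ℝ :=
  sInf {R | limNu (fun ν => liminf (fun n =>
    sInf ((fun A : Set (Fin n → 𝒳) =>
        (X n).pr (A ∩ {x | -Real.logb (K : ℝ) ((X n).p x / (X n).pr A) / (n : ℝ) ≥ R})) ''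
      {A | (X n).pr A ≥ 1 - ε - ν})) atTop) ≤ δ}

/-- G_{ε,δ}(R|X). -/
noncomputable def Gsecond (K : ℕ) (X : Source 𝒳) (ε δ R : ℝ) : ℝ :=
  sInf {L | limNu (fun ν => limsup (fun n =>
    sInf ((fun A : Set (Fin n → 𝒳) =>
        (X n).pr (A ∩ {x | -Real.logb (K : ℝ) ((X n).p x / (X n).pr A) / (n : ℝ)
          ≥ R + L / Real.sqrt (n : ℝ)})) ''
      {A | (X n).pr A ≥ 1 - ε - ν})) atTop) ≤ δ}

/-- G*_{ε,δ}(R|X) (optimistic version, with liminf). -/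
noncomputable def GsecondStar (K : ℕ) (X : Source 𝒳) (ε δ R : ℝ) : ℝ :=
  sInf {L | limNu (fun ν => liminf (fun n =>
    sInf ((fun A : Set (Fin n → 𝒳) =>
        (X n).pr (A ∩ {x | -Real.logb (K : ℝ) ((X n).p x / (X n).pr A) / (n : ℝ)
          ≥ R + L / Real.sqrt (n : ℝ)})) ''
      {A | (X n).pr A ≥ 1 - ε - ν})) atTop) ≤ δ}

/-- A rate R is optimistically ε-achievable by fixed-length codes. -/
def FixAchR (K : ℕ) (X : Source 𝒳) (ε R : ℝ) : Prop :=
  ∃ (M : ℕ → ℕ) (φ : ∀ n, (Fin n → 𝒳) → Fin (M n)) (ψ : ∀ n, Fin (M n) → (Fin n → 𝒳)),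
    ∀ γ > (0 : ℝ), ∃ ns : ℕ → ℕ, StrictMono ns ∧ ∀ i,
      (X (ns i)).pr {x | ψ (ns i) (φ (ns i) x) ≠ x} ≤ ε + γ ∧
      Real.logb (K : ℝ) (M (ns i) : ℝ) / (ns i : ℝ) ≤ R + γ

/-- R^f(ε|X). -/
noncomputable def Rfix (K : ℕ) (X : Source 𝒳) (ε : ℝ) : ℝ :=
  sInf {R | FixAchR K X ε R}

/-- A real L is optimistically (ε,R)-achievable by fixed-length codes. -/
def FixAchL (K : ℕ) (X : Source 𝒳) (ε R L : ℝ) : Prop :=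
  ∃ (M : ℕ → ℕ) (φ : ∀ n, (Fin n → 𝒳) → Fin (M n)) (ψ : ∀ n, Fin (M n) → (Fin n → 𝒳)),
    ∀ γ > (0 : ℝ), ∃ ns : ℕ → ℕ, StrictMono ns ∧ ∀ i,
      (X (ns i)).pr {x | ψ (ns i) (φ (ns i) x) ≠ x} ≤ ε + γ ∧
      Real.logb (K : ℝ) ((M (ns i) : ℝ) / (K : ℝ) ^ ((ns i : ℝ) * R)) / Real.sqrt (ns i : ℝ)
        ≤ L + γ

/-- L^f(ε,R|X). -/
noncomputable def Lfix (K : ℕ) (X : Source 𝒳) (ε R : ℝ) : ℝ :=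
  sInf {L | FixAchL K X ε R L}

section helpers
variable {α : Type*}

lemma pr_eq (P : Dist α) (A : Set α) : P.pr A = ∑' x, A.indicator P.p x :=
  tsum_subtype A P.p

lemma ind_summable (P : Dist α) (A : Set α) : Summable (A.indicator P.p) :=
  P.hasSum.summable.indicator A

lemma pr_nonneg (P : Dist α) (A : Set α) : 0 ≤ P.pr A :=
  tsum_nonneg fun x => P.nonneg x.1

lemma pr_mono' (P : Dist α) {A B : Set α} (h : ∀ x ∈ A, 0 < P.p x → x ∈ B) : P.pr A ≤ P.pr B := by
  rw [pr_eq, pr_eq]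
  refine (ind_summable P A).tsum_le_tsum (fun x => ?_) (ind_summable P B)
  by_cases hA : x ∈ A
  · rcases (P.nonneg x).lt_or_eq with h0 | h0
    · simp [hA, h x hA h0]
    · have := Set.indicator_apply_nonneg (s := B) (fun _ => P.nonneg x)
      simpa [hA, ← h0] using this
  · have := Set.indicator_apply_nonneg (s := B) (fun _ => P.nonneg x)
    simpa [hA] using this

lemma pr_mono (P : Dist α) {A B : Set α} (h : A ⊆ B) : P.pr A ≤ P.pr B :=
  pr_mono' P fun x hx _ => h hx

lemma pr_compl (P : Dist α) (A : Set α) : P.pr Aᶜ = 1 - P.pr A := by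
  have h := (ind_summable P A).tsum_add (ind_summable P Aᶜ)
  have h2 : (∑' x, (A.indicator P.p x + Aᶜ.indicator P.p x)) = 1 := by
    rw [← P.hasSum.tsum_eq]
    congr 1; ext x
    exact congrFun (Set.indicator_self_add_compl A P.p) x
  rw [pr_eq, pr_eq]; linarith

lemma pr_le_one (P : Dist α) (A : Set α) : P.pr A ≤ 1 := by
  have := pr_compl P A
  have := pr_nonneg P Aᶜ
  linarith

lemma pr_union_le (P : Dist α) (A B : Set α) : P.pr (A ∪ B) ≤ P.pr A + P.pr B := by
  rw [pr_eq, pr_eq, pr_eq, ← (ind_summable P A).tsum_add (ind_summable P B)]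
  refine (ind_summable P _).tsum_le_tsum (fun x => ?_) ((ind_summable P A).add (ind_summable P B))
  have h1 := P.nonneg x
  by_cases hA : x ∈ A <;> by_cases hB : x ∈ B <;> simp [hA, hB, h1]

lemma pr_finset (P : Dist α) (S : Finset α) : P.pr (S : Set α) = ∑ x ∈ S, P.p x :=
  Finset.tsum_subtype S P.p

lemma p_le_pr (P : Dist α) {A : Set α} {x : α} (h : x ∈ A) : P.p x ≤ P.pr A := by
  have h1 : P.pr (({x} : Finset α) : Set α) ≤ P.pr A := pr_mono P (by simpa using h)
  rw [pr_finset] at h1; simpa using h1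

/-- limsup characterization -/
lemma limsup_le_char {u : ℕ → ℝ} (h0 : ∀ n, 0 ≤ u n) (h1 : ∀ n, u n ≤ 1) (a : ℝ) :
    limsup u atTop ≤ a ↔ ∀ ν > 0, ∀ᶠ n in atTop, u n ≤ a + ν := by
  have hb : IsBoundedUnder (· ≤ ·) atTop u := isBoundedUnder_of ⟨1, h1⟩
  have hc : IsCoboundedUnder (· ≤ ·) atTop u :=
    (isBoundedUnder_of ⟨0, h0⟩ : IsBoundedUnder (· ≥ ·) atTop u).isCoboundedUnder_le
  constructor
  · intro h ν hν
    filter_upwards [eventually_lt_of_limsup_lt (b := a + ν) (by linarith) hb] with n hn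
    exact hn.le
  · intro h
    refine le_of_forall_pos_le_add fun ν hν => ?_
    exact limsup_le_of_le hc (h ν hν)

lemma choose_seq {C : ℕ → Type*} [∀ n, Nonempty (C n)] (F : ∀ n, C n → ℝ) (b : ℝ)
    (hF : ∀ n c, b ≤ F n c) (h : ∀ ν > 0, ∀ᶠ n in atTop, ∃ c, F n c ≤ ν) :
    ∃ c : ∀ n, C n, ∀ ν > 0, ∀ᶠ n in atTop, F n (c n) ≤ ν := by
  have key : ∀ n : ℕ, ∃ c : C n, F n c < (⨅ c, F n c) + 1 / ((n : ℝ) + 1) := fun n =>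
    exists_lt_of_ciInf_lt (by have : (0:ℝ) < 1 / ((n : ℝ) + 1) := by positivity
                              linarith)
  choose c hc using key
  refine ⟨c, fun ν hν => ?_⟩
  have ht := (tendsto_one_div_add_atTop_nhds_zero_nat (𝕜 := ℝ)).eventually_lt_const (half_pos hν)
  filter_upwards [h (ν / 2) (half_pos hν), ht] with n hn ht
  obtain ⟨d, hd⟩ := hn
  have := ciInf_le (f := F n) ⟨b, by rintro _ ⟨c, rfl⟩; exact hF n c⟩ d
  have := hc n
  linarith

lemma pr_le_card (P : Dist α) (A : Set α) (t : ℝ) (N : ℕ) (ht : ∀ x ∈ A, P.p x ≤ t) (ht0 : 0 ≤ t)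
    (hfin : A.Finite) (hN : A.ncard ≤ N) : P.pr A ≤ N * t := by
  have h1 : P.pr A = ∑ x ∈ hfin.toFinset, P.p x := by rw [← pr_finset]; simp
  rw [h1]
  calc _ ≤ ∑ x ∈ hfin.toFinset, t := Finset.sum_le_sum fun x hx => ht x (by simpa using hx)
    _ = (A.ncard : ℝ) * t := by rw [Finset.sum_const, nsmul_eq_mul, Set.ncard_eq_toFinset_card A hfin]
    _ ≤ _ := by gcongr

lemma words_card (K m : ℕ) (hK : 2 ≤ K) :
    ({u : Word K | u.1.length ≤ m}).Finite ∧ ({u : Word K | u.1.length ≤ m}).ncard ≤ K ^ (m + 1) := by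
  let f : {u : Word K | u.1.length ≤ m} → Σ i : Fin (m + 1), List.Vector (Fin K) i :=
    fun u => ⟨⟨u.1.1.length, Nat.lt_succ_of_le u.2⟩, ⟨u.1.1, rfl⟩⟩
  have hf : Function.Injective f := by
    intro u v h
    have hg : ∀ w, ((f w).2 : List.Vector (Fin K) (f w).1).toList = w.1.1 := fun w => rfl
    apply Subtype.ext; apply Subtype.ext
    rw [← hg u, ← hg v, h]
  haveI : Finite {u : Word K | u.1.length ≤ m} := Finite.of_injective f hf
  refine ⟨Set.toFinite _, ?_⟩
  have h1 := Nat.card_le_card_of_injective f hf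
  rw [Nat.card_coe_set_eq] at h1
  refine h1.trans ?_
  rw [Nat.card_eq_fintype_card, Fintype.card_sigma]
  simp only [card_vector, Fintype.card_fin]
  rw [Fin.sum_univ_eq_sum_range (fun i => K ^ i)]
  exact (Nat.geomSum_lt hK (by simp)).le

lemma conv_one (P : Dist α) (K : ℕ) (hK : 2 ≤ K) (φ : α → Word K) (ψ : Word K → α) (n : ℕ)
    (hn : 0 < n) (R γ : ℝ) (hR : 0 ≤ R) (hγ : 0 < γ) (A : Set α) (hA : A = {x | ψ (φ x) = x}) :
    P.pr (A ∩ {x | -Real.logb (K : ℝ) (P.p x / P.pr A) / (n : ℝ) ≥ R + γ})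
      ≤ ovP P φ (n * R) + K * (K : ℝ) ^ (-(n * γ)) := by
  have hK1 : (1 : ℝ) < K := by exact_mod_cast (by omega : 1 < K)
  have hn' : (0 : ℝ) < n := by exact_mod_cast hn
  set m := ⌊(n : ℝ) * R⌋₊ with hm
  have hnR : 0 ≤ (n : ℝ) * R := by positivity
  set S : Set α := {x | ψ (φ x) = x ∧ (φ x).1.length ≤ m ∧ P.p x ≤ (K : ℝ) ^ (-(n * (R + γ)))} with hS
  have hsub : P.pr (A ∩ {x | -Real.logb (K : ℝ) (P.p x / P.pr A) / (n : ℝ) ≥ R + γ}) ≤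
      P.pr ({x | wlen (φ x) > n * R} ∪ S) := by
    refine pr_mono' P ?_
    rintro x ⟨hx, hx2⟩ hpos
    have hAp : 0 < P.pr A := hpos.trans_le (p_le_pr P hx)
    by_cases hl : wlen (φ x) > n * R
    · exact Or.inl hl
    · right
      refine ⟨by simpa [hA] using hx, Nat.le_floor (not_lt.mp hl), ?_⟩
      have h2 : Real.logb K (P.p x / P.pr A) ≤ -(n * (R + γ)) := by
        have h3 : R + γ ≤ -Real.logb (K : ℝ) (P.p x / P.pr A) / (n : ℝ) := hx2
        rw [le_div_iff₀ hn'] at h3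
        linarith
      rw [Real.logb_le_iff_le_rpow hK1 (by positivity), div_le_iff₀ hAp] at h2
      refine h2.trans (mul_le_of_le_one_right (by positivity) (pr_le_one P A))
  have hinj : Set.InjOn φ S := by
    intro x hx y hy h
    rw [← hx.1, ← hy.1, h]
  obtain ⟨hf, hc⟩ := words_card K m hK
  have hmaps : Set.MapsTo φ S {u : Word K | u.1.length ≤ m} := fun x hx => hx.2.1
  have hSf : S.Finite := Set.Finite.of_injOn hmaps hinj hf
  have hSc : S.ncard ≤ K ^ (m + 1) := (Set.ncard_le_ncard_of_injOn φ hmaps hinj hf).trans hc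
  have hS2 := pr_le_card P S _ _ (fun x hx => hx.2.2) (by positivity) hSf hSc
  refine hsub.trans ((pr_union_le P _ _).trans (add_le_add le_rfl (hS2.trans ?_)))
  have hmle : (m : ℝ) ≤ n * R := Nat.floor_le hnR
  push_cast
  rw [pow_succ', mul_assoc, ← Real.rpow_natCast, ← Real.rpow_add (by linarith)]
  gcongr
  · exact hK1.le
  · nlinarith

lemma ach_one [Countable α] (P : Dist α) (K : ℕ) (hK : 2 ≤ K) (A : Set α) (n m : ℕ)
    (hn : 0 < n) (hm : 1 ≤ m) (R : ℝ) (hRm : n * R ≤ m) :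
    ∃ (φ : α → Word K) (ψ : Word K → α), errP P φ ψ ≤ 1 - P.pr A ∧
      ovP P φ m ≤ P.pr (A ∩ {x | -Real.logb (K : ℝ) (P.p x / P.pr A) / (n : ℝ) ≥ R}) := by
  classical
  have hK1 : (1 : ℝ) < K := by exact_mod_cast (by omega : 1 < K)
  have hn' : (0 : ℝ) < n := by exact_mod_cast hn
  haveI : Nonempty α := by
    by_contra h
    rw [not_nonempty_iff] at h
    have h1 := P.hasSum.tsum_eq
    simp at h1
  haveI : NeZero K := ⟨by omega⟩
  set B : Set α := {x | x ∈ A ∧ 0 < P.p x ∧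
    ¬ (-Real.logb (K : ℝ) (P.p x / P.pr A) / (n : ℝ) ≥ R)} with hB
  have hcard : ∀ S : Finset α, (S : Set α) ⊆ B → S.card ≤ K ^ m := by
    intro S hS
    rcases S.eq_empty_or_nonempty with rfl | ⟨x0, hx0⟩
    · simp
    have hAp : 0 < P.pr A := (hS hx0).2.1.trans_le (p_le_pr P (hS hx0).1)
    have h1 : ∀ x ∈ S, (K : ℝ) ^ (-(n * R)) * P.pr A ≤ P.p x := by
      intro x hx
      obtain ⟨_, h2, h3⟩ := hS hx
      rw [ge_iff_le, le_div_iff₀ hn', not_le] at h3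
      have h4 : -(n * R) ≤ Real.logb K (P.p x / P.pr A) := by linarith
      rwa [Real.le_logb_iff_rpow_le hK1 (by positivity), le_div_iff₀ hAp] at h4
    have h2 := Finset.sum_le_sum h1
    rw [Finset.sum_const, nsmul_eq_mul, ← pr_finset, ← mul_assoc] at h2
    have h3 : P.pr (S : Set α) ≤ 1 * P.pr A := by
      rw [one_mul]; exact pr_mono P fun x hx => (hS hx).1
    have h4 := le_of_mul_le_mul_right (h2.trans h3) hAp
    rw [Real.rpow_neg (by positivity), ← div_eq_mul_inv, div_le_one (by positivity)] at h4
    have h5 : (K : ℝ) ^ ((n : ℝ) * R) ≤ (K : ℝ) ^ (m : ℝ) := Real.rpow_le_rpow_of_exponent_le hK1.le hRm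
    rw [Real.rpow_natCast] at h5
    exact_mod_cast h4.trans h5
  have hBf : B.Finite := by
    by_contra hinf
    obtain ⟨S, hS, hc⟩ := Set.Infinite.exists_subset_card_eq hinf (K ^ m + 1)
    have := hcard S hS
    omega
  haveI : Fintype B := hBf.fintype
  have hBc : Fintype.card B ≤ Fintype.card (Fin m → Fin K) := by
    have := hcard B.toFinset (by simp)
    rw [Set.toFinset_card] at this
    simpa using this
  obtain ⟨f⟩ := Function.Embedding.nonempty_of_card_le hBc
  obtain ⟨e, he⟩ := exists_injective_nat α
  have hne : ∀ l : List (Fin K), 1 ≤ l.length → l ≠ [] := by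
    rintro l hl rfl; simp at hl
  let φ : α → Word K := fun x =>
    if h : x ∈ B then ⟨List.ofFn (f ⟨x, h⟩), hne _ (by simpa using hm)⟩
    else if x ∈ A then ⟨List.replicate (m + 1 + e x) 0, hne _ (by simp; omega)⟩
    else ⟨List.replicate m 0, hne _ (by simpa using hm)⟩
  have hφB : ∀ x (h : x ∈ B), (φ x).1 = List.ofFn (f ⟨x, h⟩) := fun x h => by simp [φ, h]
  have hφA : ∀ x, x ∉ B → x ∈ A → (φ x).1 = List.replicate (m + 1 + e x) 0 := fun x h h' => by
    simp [φ, h, h']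
  have hφC : ∀ x, x ∉ B → x ∉ A → (φ x).1 = List.replicate m 0 := fun x h h' => by
    simp [φ, h, h']
  have hlen : ∀ x, wlen (φ x) > m → x ∈ A ∧ x ∉ B := by
    intro x hx
    unfold wlen at hx
    have hx : m < (φ x).1.length := by exact_mod_cast hx
    by_cases h : x ∈ B
    · rw [hφB x h] at hx; simp at hx
    · by_cases h' : x ∈ A
      · exact ⟨h', h⟩
      · rw [hφC x h h'] at hx; simp at hx
  have hinj : Set.InjOn φ A := by
    intro x hx y hy h
    have h1 : (φ x).1 = (φ y).1 := by rw [h]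
    have h2 := congrArg List.length h1
    by_cases hxB : x ∈ B <;> by_cases hyB : y ∈ B
    · rw [hφB x hxB, hφB y hyB] at h1
      have := f.injective (List.ofFn_injective h1)
      exact congrArg Subtype.val this
    · rw [hφB x hxB, hφA y hyB hy] at h2; simp at h2; omega
    · rw [hφB y hyB, hφA x hxB hx] at h2; simp at h2; omega
    · rw [hφA x hxB hx, hφA y hyB hy] at h2; simp at h2; exact he h2
  refine ⟨φ, Function.invFunOn φ A, ?_, ?_⟩
  · rw [← pr_compl]
    refine pr_mono P fun x hx hxA => hx ?_
    exact hinj.leftInvOn_invFunOn hxA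
  · refine pr_mono' P fun x hx hpos => ?_
    obtain ⟨h1, h2⟩ := hlen x hx
    refine ⟨h1, ?_⟩
    by_contra h3
    exact h2 ⟨h1, hpos, h3⟩

end helpers

noncomputable def gq {α : Type*} (K : ℕ) (P : Dist α) (n : ℕ) (a R : ℝ) : ℝ :=
  sInf ((fun A : Set α =>
        P.pr (A ∩ {x | -Real.logb (K : ℝ) (P.p x / P.pr A) / (n : ℝ) ≥ R})) ''
      {A | P.pr A ≥ a})

def Gset (K : ℕ) (X : Source 𝒳) (ε δ : ℝ) : Set ℝ :=
  {R | limNu (fun ν => limsup (fun n => gq K (X n) n (1 - ε - ν) R) atTop) ≤ δ}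

lemma gq_bdd {α : Type*} (K : ℕ) (P : Dist α) (n : ℕ) (a R : ℝ) :
    BddBelow ((fun A : Set α =>
        P.pr (A ∩ {x | -Real.logb (K : ℝ) (P.p x / P.pr A) / (n : ℝ) ≥ R})) ''
      {A | P.pr A ≥ a}) := ⟨0, by rintro _ ⟨A, _, rfl⟩; exact pr_nonneg P _⟩

lemma gq_le {α : Type*} (K : ℕ) (P : Dist α) (n : ℕ) (a R : ℝ) (A : Set α) (hA : P.pr A ≥ a) :
    gq K P n a R ≤ P.pr (A ∩ {x | -Real.logb (K : ℝ) (P.p x / P.pr A) / (n : ℝ) ≥ R}) :=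
  csInf_le (gq_bdd K P n a R) ⟨A, hA, rfl⟩

lemma gq_nonneg {α : Type*} (K : ℕ) (P : Dist α) (n : ℕ) (a R : ℝ) : 0 ≤ gq K P n a R :=
  Real.sInf_nonneg (by rintro _ ⟨A, _, rfl⟩; exact pr_nonneg P _)

lemma pr_univ {α : Type*} (P : Dist α) : P.pr Set.univ = 1 := by
  rw [pr_eq, Set.indicator_univ, P.hasSum.tsum_eq]

lemma gq_le_one {α : Type*} (K : ℕ) (P : Dist α) (n : ℕ) (a R : ℝ) : gq K P n a R ≤ 1 := by
  by_cases h : ∃ A, P.pr A ≥ a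
  · obtain ⟨A, hA⟩ := h
    exact (gq_le K P n a R A hA).trans (pr_le_one P _)
  · have : {A | P.pr A ≥ a} = ∅ := by
      rw [Set.eq_empty_iff_forall_notMem]; exact fun A hA => h ⟨A, hA⟩
    unfold gq; rw [this]; simp

lemma gq_lt_ex {α : Type*} (K : ℕ) (P : Dist α) (n : ℕ) (a R b : ℝ) (ha : a ≤ 1)
    (h : gq K P n a R < b) :
    ∃ A, P.pr A ≥ a ∧ P.pr (A ∩ {x | -Real.logb (K : ℝ) (P.p x / P.pr A) / (n : ℝ) ≥ R}) < b := by
  obtain ⟨_, ⟨A, hA, rfl⟩, h2⟩ := exists_lt_of_csInf_lt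
    (Set.Nonempty.image _ ⟨Set.univ, by simpa [pr_univ] using ha⟩) h
  exact ⟨A, hA, h2⟩

lemma mem_Gset (K : ℕ) (X : Source 𝒳) (ε δ R : ℝ) :
    R ∈ Gset K X ε δ ↔ ∀ ν > 0, ∀ γ > 0, ∀ᶠ n in atTop, gq K (X n) n (1 - ε - ν) R ≤ δ + γ := by
  have hc := fun ν => limsup_le_char (u := fun n => gq K (X n) n (1 - ε - ν) R)
    (fun n => gq_nonneg _ _ _ _ _) (fun n => gq_le_one _ _ _ _ _)
  unfold Gset limNu
  rw [Set.mem_setOf_eq, csSup_le_iff]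
  · constructor
    · intro h ν hν
      exact (hc ν δ).1 (h _ ⟨ν, hν, rfl⟩)
    · rintro h _ ⟨ν, hν, rfl⟩
      exact (hc ν δ).2 (h ν hν)
  · refine ⟨1, ?_⟩
    rintro _ ⟨ν, hν, rfl⟩
    refine (hc ν 1).2 fun γ hγ => Eventually.of_forall fun n => ?_
    have := gq_le_one K (X n) n (1 - ε - ν) R
    linarith
  · exact ⟨_, 1, Set.mem_Ioi.2 one_pos, rfl⟩

lemma Gset_pos (K : ℕ) (hK : 2 ≤ K) (X : Source 𝒳) (ε δ : ℝ) (hε0 : 0 ≤ ε) (hεδ : ε + δ < 1)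
    (R : ℝ) (hR : R ∈ Gset K X ε δ) : 0 < R := by
  by_contra hR0
  rw [not_lt] at hR0
  rw [mem_Gset] at hR
  have hν : 0 < (1 - ε - δ) / 3 := by linarith
  obtain ⟨n, hn⟩ := (hR _ hν _ hν).exists
  obtain ⟨A, hA, hA2⟩ := gq_lt_ex K (X n) n (1 - ε - (1 - ε - δ) / 3) R (1 - ε - (1 - ε - δ) / 3)
    (by linarith) (by linarith)
  have hK1 : (1 : ℝ) < K := by exact_mod_cast (by omega : 1 < K)
  have : (X n).pr A ≤ (X n).pr
      (A ∩ {x | -Real.logb (K : ℝ) ((X n).p x / (X n).pr A) / (n : ℝ) ≥ R}) := by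
    refine pr_mono' _ fun x hx hpos => ⟨hx, ?_⟩
    have h1 := p_le_pr (X n) hx
    have h2 : Real.logb K ((X n).p x / (X n).pr A) ≤ 0 :=
      Real.logb_nonpos hK1 (div_nonneg hpos.le (hpos.le.trans h1)) (div_le_one_of_le₀ h1 (hpos.le.trans h1))
    exact hR0.trans (div_nonneg (by linarith) (by positivity))
  linarith

lemma conv_main (K : ℕ) (hK : 2 ≤ K) (X : Source 𝒳) (ε δ R γ : ℝ) (hγ : 0 < γ)
    (h : FirstAch K X ε δ R) : R + γ ∈ Gset K X ε δ := by
  obtain ⟨hR, φ, ψ, he, ho⟩ := h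
  replace he := (limsup_le_char (u := fun n => errP (X n) (φ n) (ψ n))
    (fun n => pr_nonneg _ _) (fun n => pr_le_one _ _) _).1 he
  replace ho := (limsup_le_char (u := fun n => ovP (X n) (φ n) ((n : ℝ) * R))
    (fun n => pr_nonneg _ _) (fun n => pr_le_one _ _) _).1 ho
  rw [mem_Gset]
  intro ν hν γ' hγ'
  have hK1 : (1 : ℝ) < K := by exact_mod_cast (by omega : 1 < K)
  have ht : Tendsto (fun n : ℕ => (K : ℝ) * (K : ℝ) ^ (-((n : ℝ) * γ))) atTop (nhds 0) := by
    have h1 : Tendsto (fun n : ℕ => (K : ℝ) * ((K : ℝ) ^ (-γ)) ^ n) atTop (nhds (K * 0)) :=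
      (tendsto_pow_atTop_nhds_zero_of_lt_one (by positivity)
        (Real.rpow_lt_one_of_one_lt_of_neg hK1 (by linarith))).const_mul _
    rw [mul_zero] at h1
    refine h1.congr fun n => ?_
    rw [← Real.rpow_mul_natCast (by positivity)]
    ring_nf
  filter_upwards [he ν hν, ho (γ' / 2) (half_pos hγ'), ht.eventually_lt_const (half_pos hγ'),
    eventually_gt_atTop 0] with n h1 h2 h3 h4
  have hA : (X n).pr {x | ψ n (φ n x) = x} ≥ 1 - ε - ν := by
    have h5 : errP (X n) (φ n) (ψ n) = 1 - (X n).pr {x | ψ n (φ n x) = x} := by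
      rw [← pr_compl]; rfl
    linarith
  have h6 := gq_le K (X n) n _ (R + γ) _ hA
  have h7 := conv_one (X n) K hK (φ n) (ψ n) n h4 R γ hR hγ _ rfl
  linarith

lemma ach_main {𝒳 : Type*} [Countable 𝒳] (K : ℕ) (hK : 2 ≤ K) (X : Source 𝒳) (ε δ : ℝ)
    (hε0 : 0 ≤ ε) (hεδ : ε + δ < 1) (R γ : ℝ) (hγ : 0 < γ)
    (h : R ∈ Gset K X ε δ) : FirstAch K X ε δ (R + γ) := by
  have hR := Gset_pos K hK X ε δ hε0 hεδ R h
  rw [mem_Gset] at h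
  have hkey : ∀ ν > 0, ∀ᶠ n in atTop, ∃ c : ((Fin n → 𝒳) → Word K) × (Word K → (Fin n → 𝒳)),
      max (errP (X n) c.1 c.2 - ε) (ovP (X n) c.1 ((n : ℝ) * (R + γ)) - δ) ≤ ν := by
    intro ν hν
    have hlarge : Tendsto (fun n : ℕ => (n : ℝ) * γ) atTop atTop :=
      tendsto_natCast_atTop_atTop.atTop_mul_const hγ
    filter_upwards [h ν hν (ν / 2) (half_pos hν), hlarge.eventually_ge_atTop 1,
      eventually_gt_atTop 0] with n h1 h2 h3
    obtain ⟨A, hA, hA2⟩ := gq_lt_ex K (X n) n (1 - ε - ν) R (δ + ν) (by linarith) (by linarith)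
    have h3' : (0 : ℝ) < n := by exact_mod_cast h3
    have hnR : 0 < (n : ℝ) * R := by positivity
    have hlt := Nat.lt_floor_add_one ((n : ℝ) * (R + γ))
    have hle := Nat.floor_le (a := (n : ℝ) * (R + γ)) (by positivity)
    have hm : 1 ≤ ⌊(n : ℝ) * (R + γ)⌋₊ := Nat.le_floor (by push_cast; linarith)
    obtain ⟨φ, ψ, h5, h6⟩ := ach_one (X n) K hK A n ⌊(n : ℝ) * (R + γ)⌋₊ h3 hm R (by linarith)
    refine ⟨(φ, ψ), max_le ?_ ?_⟩
    · simp only; linarith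
    · have h7 : ovP (X n) φ ((n : ℝ) * (R + γ)) ≤ ovP (X n) φ (⌊(n : ℝ) * (R + γ)⌋₊ : ℝ) :=
        pr_mono _ fun x hx => lt_of_le_of_lt hle hx
      simp only; linarith
  have hne : ∀ n, Nonempty (((Fin n → 𝒳) → Word K) × (Word K → (Fin n → 𝒳))) := by
    intro n
    have : Nonempty (Fin n → 𝒳) := by
      by_contra h
      rw [not_nonempty_iff] at h
      have h1 := (X n).hasSum.tsum_eq
      simp at h1
    obtain ⟨x⟩ := this
    exact ⟨fun _ => ⟨[⟨0, by omega⟩], by simp⟩, fun _ => x⟩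
  obtain ⟨c, hc⟩ := choose_seq (fun n (c : ((Fin n → 𝒳) → Word K) × (Word K → (Fin n → 𝒳))) =>
    max (errP (X n) c.1 c.2 - ε) (ovP (X n) c.1 ((n : ℝ) * (R + γ)) - δ)) (-ε)
    (fun n c => le_max_of_le_left (by
      have : 0 ≤ errP (X n) c.1 c.2 := pr_nonneg _ _
      linarith)) hkey
  refine ⟨by linarith, fun n => (c n).1, fun n => (c n).2, ?_, ?_⟩
  · refine (limsup_le_char (fun n => pr_nonneg _ _) (fun n => pr_le_one _ _) _).2 fun ν hν => ?_
    filter_upwards [hc ν hν] with n hn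
    have h8 : errP (X n) (c n).1 (c n).2 - ε ≤ ν := (le_max_left _ _).trans hn
    have h9 : errP (X n) (c n).1 (c n).2 ≤ ε + ν := by linarith
    exact h9
  · refine (limsup_le_char (fun n => pr_nonneg _ _) (fun n => pr_le_one _ _) _).2 fun ν hν => ?_
    filter_upwards [hc ν hν] with n hn
    have h8 : ovP (X n) (c n).1 ((n : ℝ) * (R + γ)) - δ ≤ ν := (le_max_right _ _).trans hn
    have h9 : ovP (X n) (c n).1 ((n : ℝ) * (R + γ)) ≤ δ + ν := by linarith
    exact h9

/-- first-order (ε,δ)-optimum threshold, general formula. -/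
theorem statement3 {𝒳 : Type*} [Countable 𝒳] (K : ℕ) (hK : 2 ≤ K) (X : Source 𝒳)
    (ε δ : ℝ) (hε0 : 0 ≤ ε) (hε1 : ε < 1) (hδ0 : 0 ≤ δ) (hδ1 : δ < 1) (hεδ : ε + δ < 1) :
    Ropt K X ε δ = Gfirst K X ε δ := by
  have h1 : ∀ R ∈ {R | FirstAch K X ε δ R}, ∀ γ > 0, R + γ ∈ Gset K X ε δ :=
    fun R hR γ hγ => conv_main K hK X ε δ R γ hγ hR
  have h2 : ∀ R ∈ Gset K X ε δ, ∀ γ > 0, R + γ ∈ {R | FirstAch K X ε δ R} :=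
    fun R hR γ hγ => ach_main K hK X ε δ hε0 hεδ R γ hγ hR
  have b1 : BddBelow {R | FirstAch K X ε δ R} := ⟨0, fun R hR => hR.1⟩
  have b2 : BddBelow (Gset K X ε δ) := ⟨0, fun R hR => (Gset_pos K hK X ε δ hε0 hεδ R hR).le⟩
  change sInf {R | FirstAch K X ε δ R} = sInf (Gset K X ε δ)
  rcases ({R | FirstAch K X ε δ R}).eq_empty_or_nonempty with he | ⟨r, hr⟩
  · have : Gset K X ε δ = ∅ := by
      rw [Set.eq_empty_iff_forall_notMem] at he ⊢
      exact fun R hR => he _ (h2 R hR 1 one_pos)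
    rw [he, this]
  · have hne := h1 r hr 1 one_pos
    apply le_antisymm
    · refine le_csInf ⟨_, hne⟩ fun R hR => le_of_forall_pos_le_add fun γ hγ => ?_
      exact csInf_le b1 (h2 R hR γ hγ)
    · refine le_csInf ⟨_, hr⟩ fun R hR => le_of_forall_pos_le_add fun γ hγ => ?_
      exact csInf_le b2 (h1 R hR γ hγ)
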